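/- Theorem 1 (neighborhood SLB pruning): let D be a dataset, d ≥ 1 a depth limit, f : Fin p a feature, τ a threshold with optimal split score θ_τ = Split(D, d, f, τ), and UB an integer. Then any other threshold τ' with (|z_f(τ) − z_f(τ')| : ℤ) ≤ θ_τ − UB cannot yield an improving solution, i.e., Split(D, d, f, τ') ≥ UB. -/

import Mathlib

open scoped Classical

/-- A binary axis-aligned decision tree over `p` features with labels in `Y`:
either a leaf carrying a label, or a node carrying a feature, a threshold,
and two subtrees. -/
inductive DTree (p : ℕ) (Y : Type) : Type
  | leaf (lab : Y) : DTree p Y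
  | node (f : Fin p) (τ : ℝ) (l r : DTree p Y) : DTree p Y

namespace DTree

/-- A leaf classifies every `x` as its label; a node classifies `x` by the left
subtree if `x f ≤ τ` and by the right subtree otherwise. -/
noncomputable def classify {p : ℕ} {Y : Type} : DTree p Y → (Fin p → ℝ) → Y
  | leaf lab, _ => lab
  | node f τ l r, x => if x f ≤ τ then l.classify x else r.classify x

/-- The depth of a leaf is 0; the depth of a node is 1 plus the maximum of the
depths of its subtrees. -/
def depth {p : ℕ} {Y : Type} : DTree p Y → ℕ
  | leaf _ => 0
  | node _ _ l r => 1 + max l.depth r.depth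

end DTree

/-- `errors t D` is the number of observations of `D` misclassified by `t`. -/
noncomputable def errors {p : ℕ} {Y : Type} (t : DTree p Y)
    (D : Multiset ((Fin p → ℝ) × Y)) : ℕ :=
  (D.map fun xy => if t.classify xy.1 = xy.2 then 0 else 1).sum

/-- `theta D d`: the optimal misclassification score, i.e. the minimum of
`errors t D` over all decision trees `t` of depth at most `d`. -/
noncomputable def theta {p : ℕ} {Y : Type} (D : Multiset ((Fin p → ℝ) × Y))
    (d : ℕ) : ℕ :=
  sInf {n | ∃ t : DTree p Y, t.depth ≤ d ∧ errors t D = n}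

/-- `dle D f τ = D(f ≤ τ)`: the sub-multiset of observations with `x f ≤ τ`. -/
noncomputable def dle {p : ℕ} {Y : Type} (D : Multiset ((Fin p → ℝ) × Y))
    (f : Fin p) (τ : ℝ) : Multiset ((Fin p → ℝ) × Y) :=
  D.filter fun xy => xy.1 f ≤ τ

/-- `dgt D f τ = D(f > τ)`: the sub-multiset of observations with `x f > τ`. -/
noncomputable def dgt {p : ℕ} {Y : Type} (D : Multiset ((Fin p → ℝ) × Y))
    (f : Fin p) (τ : ℝ) : Multiset ((Fin p → ℝ) × Y) :=
  D.filter fun xy => τ < xy.1 f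

/-- `zf D f τ = z_f(τ) := card(D(f ≤ τ))`. -/
noncomputable def zf {p : ℕ} {Y : Type} (D : Multiset ((Fin p → ℝ) × Y))
    (f : Fin p) (τ : ℝ) : ℕ :=
  (dle D f τ).card

/-- `splitScore D d f τ = Split(D, d, f, τ) := θ(D(f ≤ τ), d−1) + θ(D(f > τ), d−1)`. -/
noncomputable def splitScore {p : ℕ} {Y : Type} (D : Multiset ((Fin p → ℝ) × Y))
    (d : ℕ) (f : Fin p) (τ : ℝ) : ℕ :=
  theta (dle D f τ) (d - 1) + theta (dgt D f τ) (d - 1)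

/-- The multiset of values of feature `f` in `D`. -/
noncomputable def featureVals {p : ℕ} {Y : Type} (D : Multiset ((Fin p → ℝ) × Y))
    (f : Fin p) : Multiset ℝ :=
  D.map fun xy => xy.1 f

/-- `midpoints D f = S^f`: the set of midpoints `(a + b) / 2` over all pairs
`a < b` of consecutive distinct values of feature `f` in `D` (i.e. no feature
value lies strictly between `a` and `b`). -/
noncomputable def midpoints {p : ℕ} {Y : Type} (D : Multiset ((Fin p → ℝ) × Y))
    (f : Fin p) : Set ℝ :=
  {m | ∃ a b : ℝ, a ∈ featureVals D f ∧ b ∈ featureVals D f ∧ a < b ∧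
    (∀ c ∈ featureVals D f, ¬(a < c ∧ c < b)) ∧ m = (a + b) / 2}

/-- `leafScore D = L(D)`: the best leaf score, the minimum over labels `ŷ` of
the number of observations of `D` whose label differs from `ŷ`. -/
noncomputable def leafScore {p : ℕ} {Y : Type} (D : Multiset ((Fin p → ℝ) × Y)) : ℕ :=
  sInf {n | ∃ lab : Y, n = (D.map fun xy => if xy.2 = lab then 0 else 1).sum}

theorem exists_errors_eq_theta {p : ℕ} {Y : Type} [Nonempty Y]
    (D : Multiset ((Fin p → ℝ) × Y)) (d : ℕ) :
    ∃ t : DTree p Y, t.depth ≤ d ∧ errors t D = theta D d :=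
  Nat.sInf_mem (s := {n | ∃ t : DTree p Y, t.depth ≤ d ∧ errors t D = n})
    ⟨_, DTree.leaf (Classical.arbitrary Y), Nat.zero_le d, rfl⟩

theorem theta_le_errors {p : ℕ} {Y : Type} (D : Multiset ((Fin p → ℝ) × Y)) {d : ℕ}
    {t : DTree p Y} (ht : t.depth ≤ d) : theta D d ≤ errors t D :=
  Nat.sInf_le ⟨t, ht, rfl⟩

theorem errors_add {p : ℕ} {Y : Type} (t : DTree p Y) (A B : Multiset ((Fin p → ℝ) × Y)) :
    errors t (A + B) = errors t A + errors t B := by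
  simp [errors]

theorem errors_le_card {p : ℕ} {Y : Type} (t : DTree p Y) (D : Multiset ((Fin p → ℝ) × Y)) :
    errors t D ≤ D.card := by
  have h := Multiset.sum_le_card_nsmul
    (D.map fun xy => if t.classify xy.1 = xy.2 then 0 else 1) 1 (by
      intro n hn
      obtain ⟨xy, -, rfl⟩ := Multiset.mem_map.1 hn
      split_ifs <;> simp)
  simpa [errors] using h

/-- The optimal score is monotone in the dataset. -/
theorem theta_mono {p : ℕ} {Y : Type} [Nonempty Y] {A B : Multiset ((Fin p → ℝ) × Y)}
    (h : A ≤ B) (d : ℕ) : theta A d ≤ theta B d := by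
  obtain ⟨C, rfl⟩ := Multiset.le_iff_exists_add.1 h
  obtain ⟨t, ht, he⟩ := exists_errors_eq_theta (A + C) d
  have := theta_le_errors A ht
  rw [errors_add] at he
  omega

/-- Adding observations increases the optimal score by at most their number. -/
theorem theta_add_card_le {p : ℕ} {Y : Type} [Nonempty Y] {A B : Multiset ((Fin p → ℝ) × Y)}
    (h : A ≤ B) (d : ℕ) : theta B d + A.card ≤ theta A d + B.card := by
  obtain ⟨C, rfl⟩ := Multiset.le_iff_exists_add.1 h
  obtain ⟨t, ht, he⟩ := exists_errors_eq_theta A d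
  have h₁ := theta_le_errors (A + C) ht
  have h₂ := errors_le_card t C
  rw [errors_add] at h₁
  rw [Multiset.card_add]
  omega

theorem dle_mono {p : ℕ} {Y : Type} (D : Multiset ((Fin p → ℝ) × Y)) (f : Fin p)
    {σ τ : ℝ} (h : σ ≤ τ) : dle D f σ ≤ dle D f τ :=
  Multiset.monotone_filter_right D fun _ hx => le_trans hx h

theorem dgt_anti {p : ℕ} {Y : Type} (D : Multiset ((Fin p → ℝ) × Y)) (f : Fin p)
    {σ τ : ℝ} (h : σ ≤ τ) : dgt D f τ ≤ dgt D f σ :=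
  Multiset.monotone_filter_right D fun _ hx => lt_of_le_of_lt h hx

theorem zf_add_card_dgt {p : ℕ} {Y : Type} (D : Multiset ((Fin p → ℝ) × Y)) (f : Fin p)
    (τ : ℝ) : zf D f τ + (dgt D f τ).card = D.card := by
  have h := congrArg Multiset.card
    (Multiset.filter_add_not (fun xy : (Fin p → ℝ) × Y => xy.1 f ≤ τ) D)
  simpa [zf, dle, dgt] using h

/-- Theorem 1 (neighborhood SLB pruning): if
`|z_f(τ) − z_f(τ')| ≤ Split(D, d, f, τ) − UB`, then `τ'` cannot yield an
improving solution: `Split(D, d, f, τ') ≥ UB`. -/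
theorem neighborhood_pruning {p : ℕ} {Y : Type} [Fintype Y] [Nonempty Y]
    (D : Multiset ((Fin p → ℝ) × Y)) (d : ℕ) (hd : 1 ≤ d) (f : Fin p)
    (τ τ' : ℝ) (UB : ℤ)
    (h : |(zf D f τ : ℤ) - (zf D f τ' : ℤ)| ≤ (splitScore D d f τ : ℤ) - UB) :
    (splitScore D d f τ' : ℤ) ≥ UB := by
  have hτ := zf_add_card_dgt D f τ
  have hτ' := zf_add_card_dgt D f τ'
  unfold splitScore at *
  rcases le_total τ τ' with hle | hle
  · have h₁ := theta_mono (dle_mono D f hle) (d - 1)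
    have h₂ := theta_add_card_le (dgt_anti D f hle) (d - 1)
    have h₃ := neg_le_abs ((zf D f τ : ℤ) - (zf D f τ' : ℤ))
    omega
  · have h₁ := theta_mono (dgt_anti D f hle) (d - 1)
    have h₂ := theta_add_card_le (dle_mono D f hle) (d - 1)
    have h₃ := le_abs_self ((zf D f τ : ℤ) - (zf D f τ' : ℤ))
    unfold zf at *
    omega
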